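/- There is no even perfect number N with 10^19 ≤ N < 10^20; that is, there is no even perfect number with exactly 20 decimal digits. -/

import Mathlib

theorem sigma_one_two_pow (k : ℕ) : ArithmeticFunction.sigma 1 (2 ^ k) = mersenne (k + 1) := by
  rw [ArithmeticFunction.sigma_one_apply, Nat.sum_divisors_prime_pow Nat.prime_two,
    Nat.geomSum_eq le_rfl, mersenne]
  simp

/-- Euler's half of the Euclid–Euler theorem. -/
theorem Nat.Perfect.eq_two_pow_mul_prime_mersenne {n : ℕ} (perf : Nat.Perfect n) (ev : Even n) :
    ∃ k : ℕ, Nat.Prime (mersenne (k + 1)) ∧ n = 2 ^ k * mersenne (k + 1) := by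
  have hpos := perf.2
  obtain ⟨k, m, hm, rfl⟩ := Nat.exists_eq_two_pow_mul_odd hpos.ne'
  have hk : k ≠ 0 := by
    rintro rfl
    rw [pow_zero, one_mul] at ev
    exact Nat.not_even_iff_odd.mpr hm ev
  have hge : 2 < 2 ^ (k + 1) := by
    calc 2 = 2 ^ 1 := (pow_one 2).symm
      _ < 2 ^ (k + 1) := Nat.pow_lt_pow_right (by norm_num) (by omega)
  have hmer := succ_mersenne (k + 1)
  rw [Nat.perfect_iff_sum_divisors_eq_two_mul hpos, ← ArithmeticFunction.sigma_one_apply,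
    ArithmeticFunction.isMultiplicative_sigma.map_mul_of_coprime
      ((Nat.coprime_two_left.mpr hm).pow_left k),
    sigma_one_two_pow, ← mul_assoc, ← pow_succ'] at perf
  have hcop : Nat.Coprime (mersenne (k + 1)) (2 ^ (k + 1)) := by
    rw [← hmer]
    simp
  obtain ⟨j, rfl⟩ := hcop.dvd_of_dvd_mul_left (Dvd.intro _ perf)
  rw [mul_left_comm] at perf
  have h := Nat.eq_of_mul_eq_mul_left (by omega) perf
  rw [ArithmeticFunction.sigma_one_apply, Nat.sum_divisors_eq_sum_properDivisors_add_self,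
    ← hmer, add_mul, one_mul, add_comm] at h
  have hj := Nat.add_left_cancel h
  rcases Nat.sum_properDivisors_dvd (hj.dvd.trans (Nat.dvd_mul_left j _)) with h1 | h1
  · obtain rfl : j = 1 := hj.symm.trans h1
    rw [mul_one, Nat.sum_properDivisors_eq_one_iff_prime] at h1
    exact ⟨k, h1, by rw [mul_one]⟩
  · have hj0 : 0 < j := Nat.pos_of_ne_zero (by rintro rfl; simp at hpos)
    nlinarith

/-- Fermat's resolution of Frenicle's challenge: there is no even perfect
number with exactly 20 decimal digits. -/
theorem no_20_digit_even_perfect :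
    ¬ ∃ N : ℕ, Even N ∧ Nat.Perfect N ∧ 10 ^ 19 ≤ N ∧ N < 10 ^ 20 := by
  rintro ⟨N, ev, perf, hlo, hhi⟩
  obtain ⟨k, hp, rfl⟩ := perf.eq_two_pow_mul_prime_mersenne ev
  have hmono {a b : ℕ} (hab : a ≤ b) :
      2 ^ a * mersenne (a + 1) ≤ 2 ^ b * mersenne (b + 1) :=
    Nat.mul_le_mul (Nat.pow_le_pow_right two_pos hab) (mersenne_le_mersenne.mpr (by omega))
  obtain rfl : k = 32 := by
    apply le_antisymm
    · by_contra! hk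
      have h33 : 10 ^ 20 ≤ 2 ^ 33 * mersenne (33 + 1) := by norm_num [mersenne]
      exact (h33.trans (hmono hk)).not_gt hhi
    · by_contra! hk
      have h31 : 2 ^ 31 * mersenne (31 + 1) < 10 ^ 19 := by norm_num [mersenne]
      exact ((hmono (Nat.le_of_lt_succ hk)).trans_lt h31).not_ge hlo
  exact absurd hp (by norm_num [mersenne])
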